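/- arXiv:1806.03102 — 4 statements merged into one kernel-verified Lean document; each statement's English description precedes it below -/
import Mathlib

section
/- Let m, n be positive natural numbers and let v : Fin n → ZMod 2 be a fixed nonzero vector. If M is a matrix drawn uniformly at random from Matrix (Fin m) (Fin n) (ZMod 2), then the probability that M.mulVec v = 0 is exactly 2^(-m). -/
open scoped ENNReal

theorem Matrix.mulVec_left_surjective {m n K : Type*} [Fintype n] [DecidableEq n] [Field K]
    {v : n → K} (hv : v ≠ 0) : Function.Surjective fun M : Matrix m n K => M.mulVec v := by
  obtain ⟨j, hj⟩ := Function.ne_iff.mp hv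
  intro w
  refine ⟨Matrix.vecMulVec w (Pi.single j (v j)⁻¹), ?_⟩
  ext i
  simp [Matrix.vecMulVec_mulVec, inv_mul_cancel₀ hj]

theorem Matrix.card_mulVec_eq_zero_mul_card {m n K : Type*} [Fintype n] [DecidableEq n] [Field K]
    {v : n → K} (hv : v ≠ 0) :
    Nat.card {M : Matrix m n K | M.mulVec v = 0} * Nat.card (m → K) =
      Nat.card (Matrix m n K) := by
  let f : Matrix m n K →+ (m → K) := Matrix.mulVec.addMonoidHomLeft v
  have hf : f.range = ⊤ := AddMonoidHom.range_eq_top.mpr (Matrix.mulVec_left_surjective hv)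
  have h := f.ker.card_mul_index
  rw [AddSubgroup.index_ker, hf, AddSubgroup.card_top] at h
  exact h

/-- If `M` is an `m × n` matrix drawn uniformly at random over `ZMod 2` and `v` is a fixed
nonzero vector, then the probability that `M.mulVec v = 0` is exactly `2^(-m)`. -/
theorem stmt_0 (m n : ℕ) (hm : 0 < m) (hn : 0 < n)
    (v : Fin n → ZMod 2) (hv : v ≠ 0) :
    (PMF.uniformOfFintype (Matrix (Fin m) (Fin n) (ZMod 2))).toOuterMeasure
      {M : Matrix (Fin m) (Fin n) (ZMod 2) | M.mulVec v = 0} = 2 ^ (-(m : ℤ)) := by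
  classical
  have h := Matrix.card_mulVec_eq_zero_mul_card (m := Fin m) hv
  have hcod : Nat.card (Fin m → ZMod 2) = 2 ^ m := by simp
  have hpos : Nat.card {M : Matrix (Fin m) (Fin n) (ZMod 2) | M.mulVec v = 0} ≠ 0 :=
    left_ne_zero_of_mul (h ▸ Nat.card_pos.ne')
  rw [PMF.toOuterMeasure_uniformOfFintype_apply, ← Nat.card_eq_fintype_card,
    ← Nat.card_eq_fintype_card, ← h, hcod, ENNReal.zpow_neg, zpow_natCast]
  push_cast
  rw [ENNReal.div_eq_inv_mul, ENNReal.mul_inv (by simp) (by simp), mul_right_comm,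
    ENNReal.inv_mul_cancel (by exact_mod_cast hpos) (ENNReal.natCast_ne_top _), one_mul]
end

section
/- Let m, n, k be positive natural numbers, let A : Fin n → ZMod 2 be a fixed vector, and let B : Fin k → (Fin n → ZMod 2) be a fixed family of k vectors such that B i ≠ A for every i. If M is a matrix drawn uniformly at random from Matrix (Fin m) (Fin n) (ZMod 2), then the probability that there exists some i : Fin k with M.mulVec A = M.mulVec (B i) is at most k · 2^(-m). (Soundness of the one-round Membership protocol: the probability of a false positive is at most k·2^(-m), by a union bound over the k strings.) -/
open scoped ENNReal

/-- Over a finite field, the `m × n` matrices annihilating a nonzero vector have density at most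
`(card K)⁻ᵐ`. -/
theorem Matrix.card_mulVec_eq_zero_mul_le {K m n : Type*} [Field K] [Fintype K] [DecidableEq K]
    [Fintype m] [DecidableEq m] [Fintype n] [DecidableEq n] {v : n → K} (hv : v ≠ 0) :
    Nat.card {M : Matrix m n K // M.mulVec v = 0} * Fintype.card K ^ Fintype.card m
      ≤ Fintype.card (Matrix m n K) := by
  obtain ⟨j, hj⟩ := Function.ne_iff.mp hv
  rw [← Fintype.card_fun, ← Nat.card_eq_fintype_card, ← Nat.card_eq_fintype_card, ← Nat.card_prod]
  refine Nat.card_le_card_of_injective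
    (fun p : {M : Matrix m n K // M.mulVec v = 0} × (m → K) =>
      p.1.1 + Matrix.vecMulVec p.2 (Pi.single j 1)) ?_
  rintro ⟨⟨M, hM⟩, w⟩ ⟨⟨N, hN⟩, u⟩ h
  have hwu : w = u := by
    have h' := congrArg (fun P : Matrix m n K => P.mulVec v) h
    funext i
    have hi := congrFun h' i
    simp only [Matrix.add_mulVec, hM, hN, Matrix.vecMulVec_mulVec] at hi
    simpa [show v j ≠ 0 from hj] using hi
  subst hwu
  simpa using h

/-- A uniformly random matrix over `ZMod 2` sends two distinct vectors to the same image with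
probability at most `2⁻ᵐ`. -/
theorem Matrix.uniform_mulVec_eq_mulVec_le {m n : ℕ} {a b : Fin n → ZMod 2} (hab : b ≠ a) :
    (PMF.uniformOfFintype (Matrix (Fin m) (Fin n) (ZMod 2))).toOuterMeasure
      {M | M.mulVec a = M.mulVec b} ≤ 2 ^ (-(m : ℤ)) := by
  classical
  have hset : {M : Matrix (Fin m) (Fin n) (ZMod 2) | M.mulVec a = M.mulVec b}
      = {M | M.mulVec (a - b) = 0} := by
    ext M
    simp [Matrix.mulVec_sub, sub_eq_zero]
  have hcard := Matrix.card_mulVec_eq_zero_mul_le (m := Fin m) (sub_ne_zero.mpr hab.symm)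
  rw [ZMod.card, Fintype.card_fin, Nat.card_eq_fintype_card] at hcard
  rw [hset, PMF.toOuterMeasure_uniformOfFintype_apply, ENNReal.zpow_neg, zpow_natCast]
  refine ENNReal.div_le_of_le_mul ?_
  rw [mul_comm, ← div_eq_mul_inv, ENNReal.le_div_iff_mul_le (by simp) (by simp)]
  exact_mod_cast hcard

/-- Soundness of the one-round Membership protocol: if `A` is a fixed vector and
`B 1, …, B k` are fixed vectors all different from `A`, and `M` is an `m × n` matrix drawn
uniformly at random over `ZMod 2`, then the probability that `M.mulVec A = M.mulVec (B i)`
for some `i` (a false positive) is at most `k * 2^(-m)`. -/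
theorem stmt_2 (m n k : ℕ) (hm : 0 < m) (hn : 0 < n) (hk : 0 < k)
    (A : Fin n → ZMod 2) (B : Fin k → (Fin n → ZMod 2)) (hB : ∀ i, B i ≠ A) :
    (PMF.uniformOfFintype (Matrix (Fin m) (Fin n) (ZMod 2))).toOuterMeasure
      {M : Matrix (Fin m) (Fin n) (ZMod 2) | ∃ i : Fin k, M.mulVec A = M.mulVec (B i)}
      ≤ (k : ℝ≥0∞) * 2 ^ (-(m : ℤ)) := by
  rw [Set.ofPred_exists]
  calc _ ≤ ∑ i : Fin k, (PMF.uniformOfFintype (Matrix (Fin m) (Fin n) (ZMod 2))).toOuterMeasure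
          {M | M.mulVec A = M.mulVec (B i)} := MeasureTheory.measure_iUnion_fintype_le _ _
    _ ≤ ∑ _i : Fin k, (2 : ℝ≥0∞) ^ (-(m : ℤ)) :=
        Finset.sum_le_sum fun i _ => Matrix.uniform_mulVec_eq_mulVec_le (hB i)
    _ = (k : ℝ≥0∞) * 2 ^ (-(m : ℤ)) := by simp
end

section
/- Let A and B be lists over an alphabet Σ, and let e, s, l be natural numbers (0-indexed positions) with s + l ≤ e and e + l < A.length, such that A.take e = B.take e and A.get (e + j) = A.get (s + j) for every j < l. Let P = B.take e and α = A.get (e + l). Then A.take (e + l + 1) = P ++ ((P.drop s).take l) ++ [α]. Moreover, if lcpLength A B < e + l + 1, then lcpLength A B = lcpLength (P ++ ((P.drop s).take l) ++ [α]) B. (This is why, once Alice and Bob know their strings agree up to the border e of the z-th phrase and disagree by the end of the (z+1)-st phrase, Alice need only send the source s, length l and symbol α of her next phrase: Bob can reconstruct Alice's prefix of length e + l + 1 from his own string and determine lcpLength A B without further communication.) -/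
/-- The length of the longest common prefix of two lists. -/
def lcpLength {α : Type*} [DecidableEq α] (X Y : List α) : ℕ :=
  ((X.zip Y).takeWhile fun p => p.1 == p.2).length

theorem lcpLength_take_left {α : Type*} [DecidableEq α] (n : ℕ) (X Y : List α) :
    lcpLength (X.take n) Y = min n (lcpLength X Y) := by
  induction n generalizing X Y with
  | zero => simp [lcpLength]
  | succ n ih =>
    cases X with
    | nil => simp [lcpLength]
    | cons x X =>
      cases Y with
      | nil => simp [lcpLength]
      | cons y Y =>
        have h := ih X Y
        by_cases hxy : x = y <;> simp_all [lcpLength]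

/-- Once Alice and Bob know their strings agree up to position `e` and Alice's next phrase
has source `s`, length `l` and following symbol `a`, Bob can reconstruct Alice's prefix of
length `e + l + 1` from his own string as `P ++ (P.drop s).take l ++ [a]` where
`P = B.take e`, and hence determine the longest common prefix if it ends before
position `e + l + 1`. -/
theorem stmt_7 {α : Type*} [DecidableEq α] (A B : List α) (e s l : ℕ)
    (hsl : s + l ≤ e) (hel : e + l < A.length)
    (heq : A.take e = B.take e)
    (hcopy : ∀ j, (hj : j < l) → A[e + j]'(by omega) = A[s + j]'(by omega))
    (P : List α) (hP : P = B.take e)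
    (a : α) (ha : a = A[e + l]'hel) :
    A.take (e + l + 1) = P ++ (P.drop s).take l ++ [a] ∧
      (lcpLength A B < e + l + 1 →
        lcpLength A B = lcpLength (P ++ (P.drop s).take l ++ [a]) B) := by
  have hprefix : A.take (e + l + 1) = P ++ (P.drop s).take l ++ [a] := by
    have hmid : (A.drop e).take l = ((A.take e).drop s).take l := by
      apply List.ext_getElem
      · simp
        omega
      · intro j hj _
        have hjl : j < l := by
          simp at hj
          omega
        simpa using hcopy j hjl
    rw [hP, ← heq, ha, ← hmid, ← List.take_add, List.take_append_getElem]
  refine ⟨hprefix, fun h => ?_⟩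
  rw [← hprefix, lcpLength_take_left, min_eq_right h.le]
end

section
/- Let X and Y be lists over an alphabet Σ and let p, q ≥ 1 be natural numbers with p + q ≤ min (X.length) (Y.length). Suppose X has period p (i.e., X.get i = X.get (i + p) whenever i + p < X.length), Y has period q (i.e., Y.get i = Y.get (i + q) whenever i + q < Y.length), and X.take (p + q) = Y.take (p + q). Then X.take (min X.length Y.length) = Y.take (min X.length Y.length); in particular lcpLength X Y = min X.length Y.length. (This underlies the protocol step for self-referential parses: once both parties' periodic phrases with periods at most e are known to agree on the next 2e symbols, the two strings agree up to the end of the shorter phrase, so the longest common prefix is determined by which phrase is shorter.) -/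
/-- Two lists with periods `p` and `q` that agree on their first `p + q` symbols agree at every
common index. -/
theorem getElem_eq_of_periodic_of_take_eq {α : Type*} {X Y : List α} {p q : ℕ}
    (hp : 1 ≤ p) (hq : 1 ≤ q)
    (hX : ∀ i, (hi : i + p < X.length) → X[i]'(by omega) = X[i + p]'hi)
    (hY : ∀ i, (hi : i + q < Y.length) → Y[i]'(by omega) = Y[i + q]'hi)
    (heq : X.take (p + q) = Y.take (p + q)) (n : ℕ) (hnX : n < X.length) (hnY : n < Y.length) :
    X[n] = Y[n] := by
  induction n using Nat.strong_induction_on with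
  | _ n ih =>
    by_cases h : n < p + q
    · have h' := congrArg (fun l : List α => l[n]?) heq
      simpa [List.getElem?_take, h, hnX, hnY] using h'
    · obtain ⟨m, rfl⟩ : ∃ m, n = m + q + p := ⟨n - q - p, by omega⟩
      have hcomm : m + q + p = m + p + q := by omega
      calc X[m + q + p] = X[m + q] := (hX (m + q) hnX).symm
        _ = Y[m + q] := ih (m + q) (by omega) (by omega) (by omega)
        _ = Y[m] := (hY m (by omega)).symm
        _ = X[m] := (ih m (by omega) (by omega) (by omega)).symm
        _ = X[m + p] := hX m (by omega)
        _ = Y[m + p] := ih (m + p) (by omega) (by omega) (by omega)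
        _ = Y[m + p + q] := hY (m + p) (by omega)
        _ = Y[m + q + p] := by simp only [hcomm]

/-- If `X` has period `p ≥ 1`, `Y` has period `q ≥ 1`, `p + q ≤ min X.length Y.length`,
and `X` and `Y` agree on their first `p + q` symbols, then they agree on their whole
overlap: `X.take (min X.length Y.length) = Y.take (min X.length Y.length)`, and in
particular `lcpLength X Y = min X.length Y.length`. -/
theorem stmt_9 {α : Type*} [DecidableEq α] (X Y : List α) (p q : ℕ)
    (hp : 1 ≤ p) (hq : 1 ≤ q) (hpq : p + q ≤ min X.length Y.length)
    (hX : ∀ i, (hi : i + p < X.length) → X[i]'(by omega) = X[i + p]'hi)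
    (hY : ∀ i, (hi : i + q < Y.length) → Y[i]'(by omega) = Y[i + q]'hi)
    (heq : X.take (p + q) = Y.take (p + q)) :
    X.take (min X.length Y.length) = Y.take (min X.length Y.length) ∧
      lcpLength X Y = min X.length Y.length := by
  have key := getElem_eq_of_periodic_of_take_eq hp hq hX hY heq
  constructor
  · apply List.ext_getElem
    · simp
    · intro n h₁ h₂
      rw [List.length_take] at h₁ h₂
      simpa using key n (by omega) (by omega)
  · have hall : (X.zip Y).takeWhile (fun p => p.1 == p.2) = X.zip Y := by
      rw [List.takeWhile_eq_self_iff]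
      intro z hz
      obtain ⟨n, hn, rfl⟩ := List.mem_iff_getElem.mp hz
      rw [List.length_zip] at hn
      simpa using key n (by omega) (by omega)
    rw [lcpLength, hall, List.length_zip]
end
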